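/- For convergent sequences k and l, the stuffle relation holds: ζ(k)·ζ(l) = ∑_{s ∈ st(k,l)} ζ(s), where the sum is over the multiset st(k,l) and ζ(k) = ∑_{n₁ > n₂ > … > n_r ≥ 1} n₁^{−k₁} ⋯ n_r^{−k_r}. -/

import Mathlib

/-- Auxiliary stuffle product on reversed sequences (prepending = appending at the
end of the original sequence). -/
def stRev : List ℕ → List ℕ → Multiset (List ℕ)
  | [], l => {l}
  | x :: k, [] => {x :: k}
  | x :: k, y :: l =>
      (stRev (x :: k) l).map (y :: ·) + (stRev k (y :: l)).map (x :: ·) +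
        (stRev k l).map ((x + y) :: ·)

/-- The stuffle product of two sequences: it satisfies
`st (k ++ [x]) (l ++ [y]) = (st (k ++ [x]) l).map (· ++ [y]) + (st k (l ++ [y])).map (· ++ [x])
  + (st k l).map (· ++ [x + y])` and `st [] k = st k [] = {k}`. -/
def st (k l : List ℕ) : Multiset (List ℕ) :=
  (stRev k.reverse l.reverse).map List.reverse

/-- The multiple zeta value `ζ(k) = ∑_{n₁ > n₂ > … > n_r ≥ 1} ∏ nᵢ^{-kᵢ}`. -/
noncomputable def zetaL (k : List ℕ) : ℝ :=
  ∑' n : {n : Fin k.length → ℕ+ // StrictAnti fun i => (n i : ℕ)},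
    ∏ i, 1 / ((n.1 i : ℕ) : ℝ) ^ k.get i

open scoped ENNReal

/-- tail multiple zeta values of reversed sequences, valued in `ℝ≥0∞` -/
noncomputable def ZT : ℕ → List ℕ → ℝ≥0∞
  | _, [] => 1
  | N, x :: r => ∑' n : ℕ+, if N < (n : ℕ) then (((n : ℕ) : ℝ≥0∞) ^ x)⁻¹ * ZT n r else 0

theorem ZT_mul_cons (N x y : ℕ) (k l : List ℕ) :
    ZT N (x :: k) * ZT N (y :: l) =
      (∑' m : ℕ+, if N < (m : ℕ) then (((m : ℕ) : ℝ≥0∞) ^ y)⁻¹ * (ZT m (x :: k) * ZT m l) else 0) +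
      (∑' n : ℕ+, if N < (n : ℕ) then (((n : ℕ) : ℝ≥0∞) ^ x)⁻¹ * (ZT n k * ZT n (y :: l)) else 0) +
      (∑' n : ℕ+, if N < (n : ℕ) then
        (((n : ℕ) : ℝ≥0∞) ^ (x + y))⁻¹ * (ZT n k * ZT n l) else 0) := by
  let f : ℕ+ → ℝ≥0∞ := fun n => (((n : ℕ) : ℝ≥0∞) ^ x)⁻¹ * ZT n k
  let g : ℕ+ → ℝ≥0∞ := fun n => (((n : ℕ) : ℝ≥0∞) ^ y)⁻¹ * ZT n l
  have hf : ∀ M, ZT M (x :: k) = ∑' n : ℕ+, if M < (n : ℕ) then f n else 0 := fun M => rfl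
  have hg : ∀ M, ZT M (y :: l) = ∑' n : ℕ+, if M < (n : ℕ) then g n else 0 := fun M => rfl
  have e1 : (∑' m : ℕ+, if N < (m : ℕ) then
      (((m : ℕ) : ℝ≥0∞) ^ y)⁻¹ * (ZT m (x :: k) * ZT m l) else 0) =
      ∑' n : ℕ+, ∑' m : ℕ+, if N < (m : ℕ) ∧ (m : ℕ) < n then f n * g m else 0 := by
    rw [ENNReal.tsum_comm]
    refine tsum_congr fun m => ?_
    by_cases h : N < (m : ℕ)
    · simp only [h, true_and, if_true, hf]
      rw [mul_left_comm, ← ENNReal.tsum_mul_right]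
      refine tsum_congr fun n => ?_
      simp only [ite_mul, zero_mul]
      rfl
    · simp [h]
  have e2 : (∑' n : ℕ+, if N < (n : ℕ) then
      (((n : ℕ) : ℝ≥0∞) ^ x)⁻¹ * (ZT n k * ZT n (y :: l)) else 0) =
      ∑' n : ℕ+, ∑' m : ℕ+, if N < (n : ℕ) ∧ (n : ℕ) < m then f n * g m else 0 := by
    refine tsum_congr fun n => ?_
    by_cases h : N < (n : ℕ)
    · simp only [h, true_and, if_true, hg]
      rw [← mul_assoc, ← ENNReal.tsum_mul_left]
      refine tsum_congr fun m => ?_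
      simp only [mul_ite, mul_zero]
      rfl
    · simp [h]
  have e3 : (∑' n : ℕ+, if N < (n : ℕ) then
        (((n : ℕ) : ℝ≥0∞) ^ (x + y))⁻¹ * (ZT n k * ZT n l) else 0) =
      ∑' n : ℕ+, ∑' m : ℕ+, if N < (n : ℕ) ∧ n = m then f n * g m else 0 := by
    refine tsum_congr fun n => ?_
    rw [tsum_eq_single n]
    · by_cases h : N < (n : ℕ)
      · simp only [h, and_self, if_true, f, g]
        rw [pow_add, ENNReal.mul_inv]
        · ring
        · left; exact pow_ne_zero _ (by simp)
        · left; exact ENNReal.pow_ne_top (by simp)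
      · simp [h]
    · intro m hm
      simp [hm.symm]
  rw [e1, e2, e3, hf, hg, ← ENNReal.tsum_mul_right, ← ENNReal.tsum_add, ← ENNReal.tsum_add]
  refine tsum_congr fun n => ?_
  rw [← ENNReal.tsum_mul_left, ← ENNReal.tsum_add, ← ENNReal.tsum_add]
  refine tsum_congr fun m => ?_
  rcases lt_trichotomy (n : ℕ) (m : ℕ) with h | h | h
  · have h1 : ¬ (m : ℕ) < n := by omega
    have h2 : n ≠ m := by rintro rfl; omega
    by_cases h3 : N < (n : ℕ)
    · have : N < (m : ℕ) := by omega
      simp [*]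
    · simp [*]
  · have h' : n = m := PNat.eq h
    subst h'
    by_cases h3 : N < (n : ℕ) <;> simp [*]
  · have h1 : ¬ (n : ℕ) < m := by omega
    have h2 : n ≠ m := by rintro rfl; omega
    by_cases h3 : N < (m : ℕ)
    · have : N < (n : ℕ) := by omega
      simp [*]
    · simp [*]

theorem ZT_sum_cons (N x : ℕ) (S : Multiset (List ℕ)) :
    ((S.map (x :: ·)).map (ZT N)).sum =
      ∑' n : ℕ+, if N < (n : ℕ) then (((n : ℕ) : ℝ≥0∞) ^ x)⁻¹ * (S.map (ZT n)).sum else 0 := by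
  induction S using Multiset.induction_on with
  | empty => simp
  | cons a S ih =>
    simp only [Multiset.map_cons, Multiset.sum_cons, ih]
    rw [ZT, ← ENNReal.tsum_add]
    refine tsum_congr fun n => ?_
    split_ifs <;> simp [mul_add]

theorem ZT_mul (k l : List ℕ) : ∀ N, ZT N k * ZT N l = ((stRev k l).map (ZT N)).sum := by
  induction k, l using stRev.induct with
  | case1 l => intro N; simp [stRev, ZT]
  | case2 x k => intro N; simp [stRev, ZT]
  | case3 x k y l h1 h2 h3 =>
    intro N
    rw [ZT_mul_cons]
    simp only [stRev, Multiset.map_add, Multiset.sum_add, ZT_sum_cons, h1, h2, h3]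

theorem tail_sq (N : ℕ) :
    (∑' n : ℕ+, if N < (n : ℕ) then (((n : ℕ) : ℝ≥0∞) ^ 2)⁻¹ else 0) ≤ 2 * ((N + 1 : ℕ) : ℝ≥0∞)⁻¹ := by
  have h0 : (∑' n : ℕ+, if N < (n : ℕ) then (((n : ℕ) : ℝ≥0∞) ^ 2)⁻¹ else 0) ≤
      ∑' n : ℕ, if N < n then ((n : ℝ≥0∞) ^ 2)⁻¹ else 0 :=
    ENNReal.tsum_comp_le_tsum_of_injective PNat.coe_injective
      (fun n : ℕ => if N < n then ((n : ℝ≥0∞) ^ 2)⁻¹ else 0)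
  refine h0.trans ?_
  rw [ENNReal.tsum_eq_iSup_nat]
  refine iSup_le fun M => ?_
  have h := sum_Ioo_inv_sq_le (α := ℝ) N M
  have h2 := ENNReal.ofReal_le_ofReal h
  rw [ENNReal.ofReal_sum_of_nonneg (fun _ _ => by positivity)] at h2
  have e : ENNReal.ofReal (2 / ((N : ℝ) + 1)) = 2 * ((N + 1 : ℕ) : ℝ≥0∞)⁻¹ := by
    rw [ENNReal.ofReal_div_of_pos (by positivity), div_eq_mul_inv]
    congr 2
    · simp
    · rw [← Nat.cast_succ, ENNReal.ofReal_natCast]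
  rw [e] at h2
  refine le_trans (le_of_eq ?_) h2
  rw [← Finset.sum_filter]
  have : (Finset.range M).filter (fun n => N < n) = Finset.Ioo N M := by
    ext a; simp [and_comm]
  rw [this]
  refine Finset.sum_congr rfl fun i hi => ?_
  have : 0 < (i : ℝ) := by
    have := (Finset.mem_Ioo.1 hi).1
    exact_mod_cast (by omega : 0 < i)
  rw [ENNReal.ofReal_inv_of_pos (by positivity), ENNReal.ofReal_pow this.le,
    ENNReal.ofReal_natCast]

theorem inv_pow_le (n : ℕ+) {a b : ℕ} (h : a ≤ b) :
    (((n : ℕ) : ℝ≥0∞) ^ b)⁻¹ ≤ (((n : ℕ) : ℝ≥0∞) ^ a)⁻¹ := by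
  apply ENNReal.inv_le_inv.2
  exact pow_le_pow_right₀ (by exact_mod_cast n.pos) h

theorem ZT_bound (a : ℕ) (ha : 2 ≤ a) (r : List ℕ) (hr : ∀ i ∈ r, 0 < i) :
    ∀ N, ZT N (r ++ [a]) ≤ 2 ^ (r.length + 1) * ((N + 1 : ℕ) : ℝ≥0∞)⁻¹ := by
  induction r with
  | nil =>
    intro N
    simp only [List.nil_append, ZT, mul_one, List.length_nil, zero_add, pow_one]
    refine le_trans (ENNReal.tsum_le_tsum fun n => ?_) (tail_sq N)
    split_ifs
    · exact inv_pow_le n ha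
    · exact le_rfl
  | cons x r ih =>
    intro N
    have ih := ih (fun i hi => hr i (List.mem_cons_of_mem _ hi))
    have hx : 1 ≤ x := hr x List.mem_cons_self
    simp only [List.cons_append, ZT, List.length_cons]
    rw [pow_succ _ (r.length + 1), mul_assoc]
    refine le_trans ?_ (mul_le_mul_right (tail_sq N) _)
    rw [← ENNReal.tsum_mul_left]
    refine ENNReal.tsum_le_tsum fun n => ?_
    split_ifs
    · have h1 := inv_pow_le n hx
      have h2 : (((n : ℕ) + 1 : ℕ) : ℝ≥0∞)⁻¹ ≤ ((n : ℕ) : ℝ≥0∞)⁻¹ :=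
        ENNReal.inv_le_inv.2 (by exact_mod_cast Nat.le_succ _)
      calc _ ≤ (((n : ℕ) : ℝ≥0∞) ^ 1)⁻¹ * (2 ^ (r.length + 1) * ((n : ℕ) : ℝ≥0∞)⁻¹) :=
            mul_le_mul' h1 ((ih n).trans (mul_le_mul' le_rfl h2))
        _ = _ := by
            rw [pow_two, ENNReal.mul_inv (by simp) (by simp), pow_one]; ring
    · simp

theorem ZT_ne_top (k : List ℕ) (hk : ∀ i ∈ k, 0 < i) (hk0 : k ≠ []) (hk2 : 2 ≤ k.headI) :
    ZT 0 k.reverse ≠ ⊤ := by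
  cases k with
  | nil => exact absurd rfl hk0
  | cons a k =>
    rw [List.reverse_cons]
    refine ne_top_of_le_ne_top ?_
      (ZT_bound a hk2 k.reverse (fun i hi => hk i (by simp at hi; simp [hi])) 0)
    apply ENNReal.mul_ne_top
    · exact ENNReal.pow_ne_top (by simp)
    · simp

open Classical in
theorem ZT_eq (r : List ℕ) : ∀ N, ZT N r = ∑' n : Fin r.length → ℕ+,
    if StrictMono n ∧ ∀ i, N < (n i : ℕ) then ∏ i, (((n i : ℕ) : ℝ≥0∞) ^ r.get i)⁻¹ else 0 := by
  induction r with
  | nil =>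
    intro N
    simp only [ZT, List.length_nil]
    rw [tsum_eq_single (fun i : Fin 0 => (i.elim0 : ℕ+))]
    · rw [if_pos ⟨fun i => i.elim0, fun i => i.elim0⟩]; simp
    · intro b hb; exact absurd (Subsingleton.elim _ _) hb
  | cons x r ih =>
    intro N
    simp only [ZT, List.length_cons]
    rw [← (Fin.consEquiv (fun _ : Fin (r.length + 1) => ℕ+)).tsum_eq, ENNReal.tsum_prod']
    refine tsum_congr fun a => ?_
    rw [ih]
    have key : ∀ n : Fin r.length → ℕ+,
        (StrictMono (Fin.cons a n : Fin (r.length + 1) → ℕ+) ∧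
          ∀ i, N < ((Fin.cons a n : Fin (r.length + 1) → ℕ+) i : ℕ)) ↔
        (N < (a : ℕ) ∧ StrictMono n ∧ ∀ i, (a : ℕ) < n i) := by
      intro n
      constructor
      · rintro ⟨h1, h2⟩
        refine ⟨by simpa using h2 0, fun i j hij => ?_, fun i => ?_⟩
        · simpa using h1 (Fin.succ_lt_succ_iff.2 hij)
        · simpa using h1 (Fin.succ_pos i)
      · rintro ⟨h1, h2, h3⟩
        refine ⟨fun i j hij => ?_, fun i => ?_⟩
        · induction j using Fin.cases with
          | zero => exact absurd hij (Fin.not_lt_zero _)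
          | succ j =>
            induction i using Fin.cases with
            | zero => simpa using h3 j
            | succ i => simpa using h2 (Fin.succ_lt_succ_iff.1 hij)
        · induction i using Fin.cases with
          | zero => simpa using h1
          | succ i => simpa using h1.trans (h3 i)
    by_cases h : N < (a : ℕ)
    · rw [if_pos h, ← ENNReal.tsum_mul_left]
      refine tsum_congr fun n => ?_
      have := key n
      simp only [h, true_and] at this
      simp only [Fin.consEquiv, Equiv.coe_fn_mk, this, mul_ite, mul_zero]
      split_ifs
      · rw [Fin.prod_univ_succ]; simp
      · rfl
    · rw [if_neg h]
      symm
      rw [ENNReal.tsum_eq_zero]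
      intro n
      have := key n
      simp only [h, false_and] at this
      simp only [Fin.consEquiv, Equiv.coe_fn_mk, this, if_false]

open Classical in
theorem zetaL_eq (k : List ℕ) : zetaL k = (ZT 0 k.reverse).toReal := by
  let e : (Fin k.length → ℕ+) ≃ (Fin k.reverse.length → ℕ+) :=
    Equiv.arrowCongr (Fin.revPerm.trans (finCongr (by simp))) (Equiv.refl _)
  have h : ZT 0 k.reverse = ∑' n : {n : Fin k.length → ℕ+ // StrictAnti fun i => (n i : ℕ)},
      ∏ i, (((n.1 i : ℕ) : ℝ≥0∞) ^ k.get i)⁻¹ := by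
    rw [ZT_eq, ← e.tsum_eq]
    have := tsum_subtype {n : Fin k.length → ℕ+ | StrictAnti fun i => (n i : ℕ)}
      (fun n => ∏ i, (((n i : ℕ) : ℝ≥0∞) ^ k.get i)⁻¹)
    refine Eq.trans (tsum_congr fun n => ?_) this.symm
    have hc : (StrictMono (e n) ∧ ∀ i, 0 < (e n i : ℕ)) ↔ StrictAnti fun i => (n i : ℕ) := by
      constructor
      · rintro ⟨h1, -⟩ i j hij
        have := @h1 (finCongr (by simp) j.rev) (finCongr (by simp) i.rev)
          (by have := Fin.rev_lt_rev.2 hij; rw [Fin.lt_def] at this ⊢; exact this)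
        simpa [e, Equiv.arrowCongr] using this
      · intro h
        refine ⟨fun i j hij => ?_, fun i => (e n i).pos⟩
        have := @h (Fin.rev (finCongr (by simp) j)) (Fin.rev (finCongr (by simp) i))
          (by rw [Fin.rev_lt_rev]; rw [Fin.lt_def] at hij ⊢; exact hij)
        simpa [e, Equiv.arrowCongr] using this
    rw [Set.indicator_apply]
    simp only [Set.mem_ofPred_eq, hc]
    split_ifs
    · refine (Fintype.prod_equiv (Fin.revPerm.trans (finCongr (by simp))) _ _ fun i => ?_).symm
      have hi : k.length - 1 - (k.length - ((i : ℕ) + 1)) = i := by omega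
      simp [e, Equiv.arrowCongr, hi]
    · rfl
  rw [h, zetaL, ENNReal.tsum_toReal_eq]
  · refine tsum_congr fun n => ?_
    rw [ENNReal.toReal_prod]
    simp
  · intro n
    refine ENNReal.prod_ne_top fun i _ => ?_
    simp

theorem stuffle_relation (k l : List ℕ)
    (hk : ∀ i ∈ k, 0 < i) (hl : ∀ i ∈ l, 0 < i)
    (hk0 : k ≠ []) (hl0 : l ≠ []) (hk2 : 2 ≤ k.headI) (hl2 : 2 ≤ l.headI) :
    zetaL k * zetaL l = ((st k l).map zetaL).sum := by
  have hfin : ((stRev k.reverse l.reverse).map (ZT 0)).sum ≠ ⊤ := by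
    rw [← ZT_mul]
    exact ENNReal.mul_ne_top (ZT_ne_top k hk hk0 hk2) (ZT_ne_top l hl hl0 hl2)
  rw [zetaL_eq, zetaL_eq, ← ENNReal.toReal_mul, ZT_mul, st, Multiset.map_map]
  generalize stRev k.reverse l.reverse = S at hfin
  induction S using Multiset.induction_on with
  | empty => simp
  | cons a S ih =>
    simp only [Multiset.map_cons, Multiset.sum_cons] at hfin ⊢
    rw [ENNReal.add_ne_top] at hfin
    rw [ENNReal.toReal_add hfin.1 hfin.2, ih hfin.2]
    simp [zetaL_eq]
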